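/- Cramer's identity for minors: let 1 ≤ m ≤ n be integers, let M be an invertible n×n matrix over a field, let F be an n×m matrix, and let A = M⁻¹F be the n×m matrix solving MA = F. Then for every subset I ⊆ {1,…,n} with |I| = m, the m×m submatrix A^I of A consisting of the rows indexed by I satisfies det(A^I) = det(M_{[I←F]}) / det(M), where M_{[I←F]} is the n×n matrix obtained from M by replacing the columns of M indexed by I (in increasing order) by the columns of F: if I = {i_1 < … < i_m}, then (M_{[I←F]})_{i j} = M_{i j} for j ∉ I and (M_{[I←F]})_{i, i_k} = F_{i k}. -/

import Mathlib

open Finset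

namespace Matrix

variable {ι κ R : Type*} [DecidableEq ι]

/-- The matrix obtained from `M` by replacing the columns indexed by `I` by those of `F`,
matched up through `e`. -/
def replaceCols (M : Matrix ι ι R) (I : Finset ι) (e : κ ≃ I) (F : Matrix ι κ R) :
    Matrix ι ι R :=
  of fun i j => if hj : j ∈ I then F i (e.symm ⟨j, hj⟩) else M i j

theorem mul_replaceCols_one [Fintype ι] [CommRing R] (M : Matrix ι ι R) (I : Finset ι)
    (e : κ ≃ I) (A : Matrix ι κ R) :
    M * replaceCols 1 I e A = replaceCols M I e (M * A) := by
  ext i j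
  by_cases hj : j ∈ I <;> simp [replaceCols, mul_apply, hj, one_apply]

theorem det_replaceCols_one [Fintype ι] [Fintype κ] [DecidableEq κ] [CommRing R]
    (I : Finset ι) (e : κ ≃ I) (A : Matrix ι κ R) :
    (replaceCols 1 I e A).det = (A.submatrix (fun k => (e k : ι)) id).det := by
  rw [twoBlockTriangular_det' _ (· ∈ I)]
  · have h_compl : toSquareBlockProp (replaceCols 1 I e A) (fun i => ¬ i ∈ I) = 1 := by
      ext i j
      simp [toSquareBlockProp, replaceCols, j.2, one_apply, Subtype.ext_iff]
    have h_block : (toSquareBlockProp (replaceCols 1 I e A) (· ∈ I)).submatrix e e =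
        A.submatrix (fun k => (e k : ι)) id := by
      ext a b
      simp [toSquareBlockProp, replaceCols]
    rw [h_compl, det_one, mul_one, ← h_block]
    rw [det_submatrix_equiv_self]
    congr!
  · intro i hi j hj
    have hij : i ≠ j := fun h => hj (h ▸ hi)
    simp [replaceCols, hj, hij]

end Matrix

/-- Cramer's identity for minors. If `M` is an invertible `n × n` matrix,
`F` an `n × m` matrix, and `A` the `n × m` matrix solving `M * A = F`, then for every
`m`-element subset `I ⊆ {1,…,n}`, `det A^I = det M_{[I ← F]} / det M`, where `A^I` is the
submatrix of rows of `A` indexed by `I` (in increasing order) and `M_{[I ← F]}` is obtained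
from `M` by replacing the columns indexed by `I` (in increasing order) by the columns of `F`. -/
theorem cramer_identity_for_minors
    {K : Type*} [Field K] {n m : ℕ} (hm : 1 ≤ m) (hmn : m ≤ n)
    (M : Matrix (Fin n) (Fin n) K) (hM : IsUnit M.det)
    (F : Matrix (Fin n) (Fin m) K)
    (A : Matrix (Fin n) (Fin m) K) (hA : M * A = F)
    (I : Finset (Fin n)) (hI : I.card = m) :
    Matrix.det (Matrix.of fun a b : Fin m => A (I.orderIsoOfFin hI a : Fin n) b) =
      Matrix.det (Matrix.of fun i j : Fin n =>
        if hj : j ∈ I then F i ((I.orderIsoOfFin hI).symm ⟨j, hj⟩) else M i j) / M.det := by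
  rw [eq_div_iff hM.ne_zero, mul_comm, ← hA]
  have h := congrArg Matrix.det
    (Matrix.mul_replaceCols_one M I (I.orderIsoOfFin hI).toEquiv A)
  rw [Matrix.det_mul, Matrix.det_replaceCols_one] at h
  exact h
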